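/- arXiv:2206.05632 — 2 statements merged into one kernel-verified Lean document; each statement's English description precedes it below -/
import Mathlib

section
/- Let s, t be real numbers with either 0 ≤ s < t < 1/2 or 1/2 < t < s ≤ 1. Then the generalized logarithmic mean L_t strongly dominates L_s: for every positive integer n and all positive real numbers λ₁, …, λₙ, the n×n matrix with (i,j) entry L_t(λᵢ, λⱼ)/L_s(λᵢ, λⱼ) is positive semidefinite. (Theorem 2.2(iii)) -/
/-- The generalized logarithmic mean `L_s(a,b) = (1/(1-2s)) ∫_s^{1-s} a^v b^{1-v} dv`. -/
noncomputable def genLogMean (s a b : ℝ) : ℝ :=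
  (1 / (1 - 2 * s)) * ∫ v in s..(1 - s), a ^ v * b ^ (1 - v)

open Filter Topology MeasureTheory

namespace Matrix

theorem PosSemidef.of_tendsto {ι α : Type*} [Fintype ι] {l : Filter α} [l.NeBot]
    {M : α → Matrix ι ι ℝ} {A : Matrix ι ι ℝ} (hM : ∀ k, (M k).PosSemidef)
    (h : Tendsto M l (𝓝 A)) : A.PosSemidef := by
  refine .of_dotProduct_mulVec_nonneg ?_ fun x => ?_
  · have hstar : Tendsto (fun k => (M k)ᴴ) l (𝓝 Aᴴ) :=
      (continuous_id.matrix_conjTranspose.tendsto A).comp h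
    exact tendsto_nhds_unique (hstar.congr fun k => (hM k).isHermitian) h
  · have hcont : Continuous fun B : Matrix ι ι ℝ => star x ⬝ᵥ (B *ᵥ x) := by fun_prop
    exact ge_of_tendsto' ((hcont.tendsto A).comp h) fun k => (hM k).dotProduct_mulVec_nonneg x

theorem PosSemidef.integral {ι α : Type*} [Fintype ι] [MeasurableSpace α] {μ : Measure α}
    {K : α → Matrix ι ι ℝ} (hK : ∀ r, (K r).PosSemidef)
    (hint : ∀ i j, Integrable (fun r => K r i j) μ) :
    (of fun i j => ∫ r, K r i j ∂μ).PosSemidef := by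
  refine .of_dotProduct_mulVec_nonneg ?_ fun x => ?_
  · ext i j
    simp only [conjTranspose_apply, of_apply, star_trivial]
    exact integral_congr_ae (.of_forall fun r => by simpa using (hK r).isHermitian.apply i j)
  · have hsum : star x ⬝ᵥ ((of fun i j => ∫ r, K r i j ∂μ) *ᵥ x)
        = ∫ r, star x ⬝ᵥ (K r *ᵥ x) ∂μ := by
      simp only [dotProduct, mulVec, of_apply]
      rw [integral_finsetSum _ fun i _ =>
        (integrable_finsetSum _ fun j _ => (hint i j).mul_const _).const_mul _]
      refine Finset.sum_congr rfl fun i _ => ?_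
      rw [integral_const_mul, integral_finsetSum _ fun j _ => (hint i j).mul_const _]
      simp only [integral_mul_const]
    rw [hsum]
    exact integral_nonneg fun r => (hK r).dotProduct_mulVec_nonneg x

theorem posSemidef_of_mul_self {ι : Type*} [Finite ι] (f : ι → ℝ) :
    (of fun i j => f i * f j).PosSemidef := by
  have := Fintype.ofFinite ι
  exact posSemidef_vecMulVec_self_star f

theorem posSemidef_cos_sub {ι : Type*} [Finite ι] (x : ι → ℝ) :
    (of fun i j => Real.cos (x i - x j)).PosSemidef := by
  convert (posSemidef_of_mul_self fun i => Real.cos (x i)).add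
    (posSemidef_of_mul_self fun i => Real.sin (x i)) using 1
  ext i j
  simp [Real.cos_sub]

theorem PosSemidef.prod {ι κ : Type*} [Finite ι] {M : κ → ι → ι → ℝ} (S : Finset κ)
    (hM : ∀ k, (of (M k)).PosSemidef) :
    (of fun i j => ∏ k ∈ S, M k i j).PosSemidef := by
  classical
  induction S using Finset.induction_on with
  | empty => simpa using posSemidef_of_mul_self fun _ : ι => (1 : ℝ)
  | insert k S hk ih =>
    simp only [Finset.prod_insert hk]
    exact (hM k).hadamard ih

end Matrix

theorem integrableOn_exp_neg_mul_cos (u : ℝ) :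
    IntegrableOn (fun r => Real.exp (-r) * Real.cos (r * u)) (Set.Ioi 0) := by
  refine (integrableOn_exp_neg_Ioi 0).mono' (by fun_prop) (.of_forall fun r => ?_)
  rw [norm_mul, Real.norm_eq_abs, Real.abs_exp]
  exact mul_le_of_le_one_right (Real.exp_pos _).le (Real.abs_cos_le_one _)

theorem integral_exp_neg_mul_cos (u : ℝ) :
    ∫ r in Set.Ioi 0, Real.exp (-r) * Real.cos (r * u) = (1 + u ^ 2)⁻¹ := by
  have ha : (-1 + u * Complex.I : ℂ).re < 0 := by simp
  have h := congrArg Complex.re (integral_exp_mul_complex_Ioi ha 0)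
  rw [← RCLike.re_to_complex, ← integral_re (integrableOn_exp_mul_complex_Ioi ha 0)] at h
  convert h using 1
  · refine integral_congr_ae (.of_forall fun r => ?_)
    simp [Complex.exp_re, mul_comm]
  · simp [Complex.div_re, Complex.normSq_apply]
    ring

theorem posSemidef_inv_one_add_sq_sub {ι : Type*} [Finite ι] (x : ι → ℝ) :
    (Matrix.of fun i j => (1 + (x i - x j) ^ 2)⁻¹).PosSemidef := by
  have := Fintype.ofFinite ι
  simp only [← integral_exp_neg_mul_cos]
  refine Matrix.PosSemidef.integral
    (K := fun r => Matrix.of fun i j => Real.exp (-r) * Real.cos (r * (x i - x j)))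
    (fun r => ?_) fun i j => integrableOn_exp_neg_mul_cos _
  simp only [mul_sub]
  exact (Matrix.posSemidef_cos_sub fun i => r * x i).smul (Real.exp_pos (-r)).le

theorem posSemidef_one_add_sq_div {ι : Type*} [Finite ι] {p q : ℝ} (hq : q ≠ 0)
    (hpq : p ^ 2 ≤ q ^ 2) (x : ι → ℝ) :
    (Matrix.of fun i j =>
      (1 + (p * (x i - x j)) ^ 2) / (1 + (q * (x i - x j)) ^ 2)).PosSemidef := by
  have hq2 : 0 < q ^ 2 := by positivity
  convert ((Matrix.posSemidef_of_mul_self fun _ : ι => (1 : ℝ)).smul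
    (a := p ^ 2 / q ^ 2) (by positivity)).add
    ((posSemidef_inv_one_add_sq_sub fun i => q * x i).smul (a := 1 - p ^ 2 / q ^ 2)
      (sub_nonneg.2 (div_le_one_of_le₀ hpq hq2.le))) using 1
  ext i j
  have : 1 + (q * (x i - x j)) ^ 2 ≠ 0 := by positivity
  simp only [Matrix.of_apply, Matrix.add_apply, Matrix.smul_apply, smul_eq_mul, ← mul_sub]
  field_simp
  ring

theorem tendsto_euler_sinh_prod (x : ℝ) :
    Tendsto (fun n : ℕ => Real.pi * x * ∏ j ∈ Finset.range n, (1 + (x / (j + 1)) ^ 2))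
      atTop (𝓝 (Real.sinh (Real.pi * x))) := by
  have h := (Complex.continuous_im.tendsto _).comp
    (Complex.tendsto_euler_sin_prod (x * Complex.I))
  rw [← mul_assoc, Complex.sin_mul_I, Complex.mul_I_im] at h
  convert h using 2 with n
  · have hprod : (∏ j ∈ Finset.range n, (1 - (x * Complex.I) ^ 2 / ((j : ℂ) + 1) ^ 2))
        = ((∏ j ∈ Finset.range n, (1 + (x / (j + 1)) ^ 2) : ℝ) : ℂ) := by
      push_cast
      refine Finset.prod_congr rfl fun j _ => ?_
      rw [mul_pow, Complex.I_sq, div_pow]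
      ring
    rw [Function.comp_apply, hprod, Complex.im_mul_ofReal]
    simp
  · rw [← Complex.ofReal_mul, ← Complex.ofReal_sinh, Complex.ofReal_re]

theorem genLogMean_self {s a : ℝ} (hs : s ≠ 1 / 2) (ha : 0 < a) : genLogMean s a a = a := by
  have hs' : 1 - 2 * s ≠ 0 := fun h => hs (by linarith)
  simp only [genLogMean, ← Real.rpow_add ha, add_sub_cancel, Real.rpow_one,
    intervalIntegral.integral_const, smul_eq_mul]
  field_simp
  ring

theorem genLogMean_eq_sinh {s a b : ℝ} (ha : 0 < a) (hb : 0 < b) (hab : a ≠ b) :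
    genLogMean s a b = Real.sqrt a * Real.sqrt b *
      (Real.sinh ((1 - 2 * s) * (Real.log a - Real.log b) / 2) /
        ((1 - 2 * s) * (Real.log a - Real.log b) / 2)) := by
  have hL : Real.log a - Real.log b ≠ 0 :=
    sub_ne_zero.2 fun h => hab (Real.log_injOn_pos ha hb h)
  have hint : ∀ v : ℝ, a ^ v * b ^ (1 - v)
      = b * Real.exp ((Real.log a - Real.log b) * v) := fun v => by
    conv_rhs => rw [← Real.exp_log hb]
    rw [Real.rpow_def_of_pos ha, Real.rpow_def_of_pos hb, ← Real.exp_add, ← Real.exp_add,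
      Real.log_exp]
    ring_nf
  have hsqrt : ∀ {c : ℝ}, 0 < c → Real.sqrt c = Real.exp (Real.log c / 2) := fun hc => by
    rw [Real.exp_half, Real.exp_log hc]
  have hexp : ∀ v : ℝ, b * Real.exp ((Real.log a - Real.log b) * v)
      = Real.sqrt a * Real.sqrt b * Real.exp ((Real.log a - Real.log b) * (v - 1 / 2)) :=
    fun v => by
      conv_lhs => rw [← Real.exp_log hb]
      rw [hsqrt ha, hsqrt hb, ← Real.exp_add, ← Real.exp_add, ← Real.exp_add, Real.log_exp]
      ring_nf
  simp only [genLogMean, hint, intervalIntegral.integral_const_mul]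
  rw [intervalIntegral.integral_comp_mul_left _ hL, integral_exp, smul_eq_mul,
    mul_left_comm b, mul_sub b, hexp, hexp, Real.sinh_eq,
    show (Real.log a - Real.log b) * (1 - s - 1 / 2)
      = (1 - 2 * s) * (Real.log a - Real.log b) / 2 by ring,
    show (Real.log a - Real.log b) * (s - 1 / 2)
      = -((1 - 2 * s) * (Real.log a - Real.log b) / 2) by ring]
  field_simp

theorem tendsto_prod_genLogMean_div {s a b : ℝ} (hs : s ≠ 1 / 2) (ha : 0 < a) (hb : 0 < b) :
    Tendsto (fun n : ℕ => ∏ j ∈ Finset.range n,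
        (1 + ((1 - 2 * s) / (2 * Real.pi * (j + 1)) * (Real.log a - Real.log b)) ^ 2))
      atTop (𝓝 (genLogMean s a b / (Real.sqrt a * Real.sqrt b))) := by
  rcases eq_or_ne a b with rfl | hab
  · simp [genLogMean_self hs ha, ha.le, ha.ne']
  have hs' : 1 - 2 * s ≠ 0 := fun h => hs (by linarith)
  have hL : Real.log a - Real.log b ≠ 0 :=
    sub_ne_zero.2 fun h => hab (Real.log_injOn_pos ha hb h)
  have hab' : Real.sqrt a * Real.sqrt b ≠ 0 := by positivity
  rw [genLogMean_eq_sinh ha hb hab, mul_div_cancel_left₀ _ hab']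
  set x := (1 - 2 * s) * (Real.log a - Real.log b) / 2 / Real.pi with hx
  have hpx : Real.pi * x = (1 - 2 * s) * (Real.log a - Real.log b) / 2 :=
    mul_div_cancel₀ _ Real.pi_ne_zero
  have hpx0 : Real.pi * x ≠ 0 := by
    rw [hpx]
    positivity
  rw [← hpx]
  refine ((tendsto_euler_sinh_prod x).div_const _).congr fun n => ?_
  rw [mul_div_cancel_left₀ _ hpx0]
  refine Finset.prod_congr rfl fun j _ => ?_
  rw [hx]
  congr 2
  field_simp

theorem genLogMean_pos {s a b : ℝ} (hs : s ≠ 1 / 2) (ha : 0 < a) (hb : 0 < b) :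
    0 < genLogMean s a b := by
  have h : 1 ≤ genLogMean s a b / (Real.sqrt a * Real.sqrt b) :=
    ge_of_tendsto' (tendsto_prod_genLogMean_div hs ha hb) fun n =>
      Finset.prod_induction _ (1 ≤ ·) (fun _ _ => one_le_mul_of_one_le_of_one_le) le_rfl
        fun j _ => le_add_of_nonneg_right (sq_nonneg _)
  have hab : 0 < Real.sqrt a * Real.sqrt b := by positivity
  exact (div_pos_iff_of_pos_right hab).1 (one_pos.trans_le h)

/-- Theorem 2.2(iii): if `0 ≤ s < t < 1/2` or `1/2 < t < s ≤ 1`, then the generalized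
logarithmic mean `L_t` strongly dominates `L_s`. -/
theorem genLog_strongly_dominates_genLog (s t : ℝ)
    (hst : (0 ≤ s ∧ s < t ∧ t < 1 / 2) ∨ (1 / 2 < t ∧ t < s ∧ s ≤ 1))
    (n : ℕ) (lam : Fin n → ℝ) (hlam : ∀ i, 0 < lam i) :
    (Matrix.of fun i j : Fin n =>
      genLogMean t (lam i) (lam j) / genLogMean s (lam i) (lam j)).PosSemidef := by
  have hs : s ≠ 1 / 2 := by rintro rfl; rcases hst with h | h <;> linarith
  have ht : t ≠ 1 / 2 := by rintro rfl; rcases hst with h | h <;> linarith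
  have hs' : 1 - 2 * s ≠ 0 := fun h => hs (by linarith)
  have hsq : (1 - 2 * t) ^ 2 ≤ (1 - 2 * s) ^ 2 := by
    rcases hst with ⟨_, h, h'⟩ | ⟨h', h, _⟩ <;> nlinarith
  refine Matrix.PosSemidef.of_tendsto (l := atTop)
    (M := fun m : ℕ => Matrix.of fun i j => ∏ k ∈ Finset.range m,
      (1 + ((1 - 2 * t) / (2 * Real.pi * (k + 1)) *
          (Real.log (lam i) - Real.log (lam j))) ^ 2) /
        (1 + ((1 - 2 * s) / (2 * Real.pi * (k + 1)) *
          (Real.log (lam i) - Real.log (lam j))) ^ 2))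
    (fun m => Matrix.PosSemidef.prod _ fun k => ?_) ?_
  · refine posSemidef_one_add_sq_div (by positivity) ?_ fun i => Real.log (lam i)
    rw [div_pow, div_pow]
    gcongr
  · refine tendsto_pi_nhds.2 fun i => tendsto_pi_nhds.2 fun j => ?_
    have hij : Real.sqrt (lam i) * Real.sqrt (lam j) ≠ 0 :=
      (mul_pos (Real.sqrt_pos.2 (hlam i)) (Real.sqrt_pos.2 (hlam j))).ne'
    have h := (tendsto_prod_genLogMean_div ht (hlam i) (hlam j)).div
      (tendsto_prod_genLogMean_div hs (hlam i) (hlam j))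
      (div_ne_zero (genLogMean_pos hs (hlam i) (hlam j)).ne' hij)
    rw [div_div_div_cancel_right₀ hij] at h
    exact h.congr fun m => (Finset.prod_div_distrib _ _).symm
end

section
/- Let A and B be n×n positive semidefinite complex matrices, X an arbitrary n×n complex matrix, and let s be a real number with 0 ≤ s < 1/2. Then ‖∫_s^{1−s} A^v X B^{1−v} dv‖_F ≤ ((1−2s)/2) ‖A^{1−s}XB^s + A^sXB^{1−s}‖_F, where ‖·‖_F denotes the Frobenius norm. (Theorem 2.4, instance for the Frobenius norm) -/
open scoped ComplexOrder

/-- Matrix power of a positive semidefinite matrix via the continuous functional calculus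
(equivalently, raising each eigenvalue to the power `v` in a spectral decomposition). -/
noncomputable def mpow {n : ℕ} (A : Matrix (Fin n) (Fin n) ℂ) (v : ℝ) :
    Matrix (Fin n) (Fin n) ℂ :=
  cfc (fun x : ℝ => x ^ v) A

/-- The Frobenius norm of a complex matrix. -/
noncomputable def frobNorm {n : ℕ} (M : Matrix (Fin n) (Fin n) ℂ) : ℝ :=
  Real.sqrt (∑ i, ∑ j, ‖M i j‖ ^ 2)

/-- The operator norm of a complex matrix induced by the Euclidean norm on `ℂⁿ`. -/
noncomputable def l2OpNorm {n : ℕ} (M : Matrix (Fin n) (Fin n) ℂ) : ℝ :=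
  ‖Matrix.toEuclideanCLM (𝕜 := ℂ) M‖

/-- The entrywise integral `∫ A^v X B^{1-v} dv` over `[s, 1-s]`. -/
noncomputable def mInt {n : ℕ} (A B X : Matrix (Fin n) (Fin n) ℂ) (s : ℝ) :
    Matrix (Fin n) (Fin n) ℂ :=
  Matrix.of fun i j => ∫ v in s..(1 - s), (mpow A v * X * mpow B (1 - v)) i j

theorem rpow_mul_rpow_le_heinz_chord {a b s v : ℝ} (ha : 0 ≤ a) (hb : 0 ≤ b) (hs0 : 0 ≤ s)
    (hs : s < 1 / 2) (hv : v ∈ Set.Icc s (1 - s)) :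
    a ^ v * b ^ (1 - v) ≤
      (1 - s - v) / (1 - 2 * s) * (a ^ s * b ^ (1 - s)) +
        (v - s) / (1 - 2 * s) * (a ^ (1 - s) * b ^ s) := by
  obtain ⟨h1, h2⟩ := hv
  have hd : 0 < 1 - 2 * s := by linarith
  have hd' : 1 - s * 2 ≠ 0 := by linarith
  set p := (1 - s - v) / (1 - 2 * s) with hp
  set q := (v - s) / (1 - 2 * s) with hq
  have hp0 : 0 ≤ p := div_nonneg (by linarith) hd.le
  have hq0 : 0 ≤ q := div_nonneg (by linarith) hd.le
  have hpq : p + q = 1 := by rw [hp, hq]; field_simp; ring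
  have hs1 : 0 ≤ 1 - s := by linarith
  have hva : v = s * p + (1 - s) * q := by rw [hp, hq]; field_simp; ring
  have hvb : 1 - v = (1 - s) * p + s * q := by rw [hp, hq]; field_simp; ring
  have key := Real.geom_mean_le_arith_mean2_weighted hp0 hq0
    (p₁ := a ^ s * b ^ (1 - s)) (p₂ := a ^ (1 - s) * b ^ s) (by positivity) (by positivity) hpq
  refine le_of_eq_of_le ?_ key
  rw [Real.mul_rpow (by positivity) (by positivity), Real.mul_rpow (by positivity) (by positivity),
    ← Real.rpow_mul ha, ← Real.rpow_mul ha, ← Real.rpow_mul hb, ← Real.rpow_mul hb, hvb]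
  nth_rewrite 1 [hva]
  rw [Real.rpow_add_of_nonneg ha (by positivity) (by positivity),
    Real.rpow_add_of_nonneg hb (by positivity) (by positivity)]
  ring

theorem intervalIntegrable_rpow_mul_rpow {a b s : ℝ} (ha : 0 ≤ a) (hb : 0 ≤ b) (hs0 : 0 ≤ s)
    (hs : s < 1 / 2) :
    IntervalIntegrable (fun v : ℝ => a ^ v * b ^ (1 - v)) MeasureTheory.volume s (1 - s) := by
  have hle : s ≤ 1 - s := by linarith
  rw [intervalIntegrable_iff_integrableOn_Icc_of_le hle]
  have hg : MeasureTheory.IntegrableOn (fun v : ℝ =>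
      (1 - s - v) / (1 - 2 * s) * (a ^ s * b ^ (1 - s)) +
        (v - s) / (1 - 2 * s) * (a ^ (1 - s) * b ^ s)) (Set.Icc s (1 - s)) :=
    (Continuous.continuousOn (by fun_prop)).integrableOn_compact isCompact_Icc
  refine hg.mono' (Measurable.aestronglyMeasurable (by fun_prop)) ?_
  filter_upwards [MeasureTheory.ae_restrict_mem measurableSet_Icc] with v hv
  rw [Real.norm_of_nonneg (by positivity)]
  exact rpow_mul_rpow_le_heinz_chord ha hb hs0 hs hv

theorem integral_rpow_mul_rpow_le {a b s : ℝ} (ha : 0 ≤ a) (hb : 0 ≤ b) (hs0 : 0 ≤ s)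
    (hs : s < 1 / 2) :
    ∫ v in s..(1 - s), a ^ v * b ^ (1 - v) ≤
      (1 - 2 * s) / 2 * (a ^ (1 - s) * b ^ s + a ^ s * b ^ (1 - s)) := by
  have hle : s ≤ 1 - s := by linarith
  have hd : 1 - 2 * s ≠ 0 := by linarith
  refine (intervalIntegral.integral_mono_on hle (intervalIntegrable_rpow_mul_rpow ha hb hs0 hs)
    (Continuous.intervalIntegrable (by fun_prop) _ _)
    fun v hv => rpow_mul_rpow_le_heinz_chord ha hb hs0 hs hv).trans_eq ?_
  rw [intervalIntegral.integral_add (Continuous.intervalIntegrable (by fun_prop) _ _)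
    (Continuous.intervalIntegrable (by fun_prop) _ _)]
  simp only [intervalIntegral.integral_mul_const, intervalIntegral.integral_div]
  have h₁ : ∫ v in s..(1 - s), (1 - s - v) = (1 - 2 * s) ^ 2 / 2 := by
    rw [intervalIntegral.integral_sub (f := fun _ => 1 - s) (g := fun v => v) (by simp) (by simp)]
    simp only [intervalIntegral.integral_const, integral_id, smul_eq_mul]
    ring
  have h₂ : ∫ v in s..(1 - s), (v - s) = (1 - 2 * s) ^ 2 / 2 := by
    rw [intervalIntegral.integral_sub (f := fun v => v) (g := fun _ => s) (by simp) (by simp)]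
    simp only [intervalIntegral.integral_const, integral_id, smul_eq_mul]
    ring
  rw [h₁, h₂]
  field_simp
  ring

theorem sum_norm_sq_eq_re_trace {n : ℕ} (M : Matrix (Fin n) (Fin n) ℂ) :
    ∑ i, ∑ j, ‖M i j‖ ^ 2 = (Matrix.trace (star M * M)).re := by
  rw [Finset.sum_comm]
  simp [Matrix.trace, Matrix.mul_apply, Matrix.star_apply, Complex.sq_norm, Complex.normSq_apply]

theorem frobNorm_unitary_mul_mul_star {n : ℕ} (U V : Matrix.unitaryGroup (Fin n) ℂ)
    (M : Matrix (Fin n) (Fin n) ℂ) :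
    frobNorm ((U : Matrix (Fin n) (Fin n) ℂ) * M * star (V : Matrix (Fin n) (Fin n) ℂ)) =
      frobNorm M := by
  unfold frobNorm
  rw [sum_norm_sq_eq_re_trace, sum_norm_sq_eq_re_trace]
  have hU : star (U : Matrix (Fin n) (Fin n) ℂ) * U = 1 := Unitary.coe_star_mul_self U
  have hV : star (V : Matrix (Fin n) (Fin n) ℂ) * V = 1 := Unitary.coe_star_mul_self V
  have h : star ((U : Matrix (Fin n) (Fin n) ℂ) * M * star (V : Matrix (Fin n) (Fin n) ℂ)) *
      ((U : Matrix (Fin n) (Fin n) ℂ) * M * star (V : Matrix (Fin n) (Fin n) ℂ)) =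
      (V : Matrix (Fin n) (Fin n) ℂ) * (star M * M * star (V : Matrix (Fin n) (Fin n) ℂ)) := by
    simp only [star_mul, star_star, mul_assoc]
    rw [← mul_assoc (star (U : Matrix (Fin n) (Fin n) ℂ)), hU, one_mul]
  rw [h, Matrix.trace_mul_comm, mul_assoc, hV, mul_one]

theorem frobNorm_le_mul_of_forall_norm_le {n : ℕ} {M N : Matrix (Fin n) (Fin n) ℂ} {c : ℝ}
    (hc : 0 ≤ c) (h : ∀ i j, ‖M i j‖ ≤ c * ‖N i j‖) : frobNorm M ≤ c * frobNorm N := by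
  unfold frobNorm
  refine Real.sqrt_le_iff.mpr ⟨by positivity, ?_⟩
  rw [mul_pow, Real.sq_sqrt (by positivity)]
  simp only [Finset.mul_sum, ← mul_pow]
  gcongr with i _ j _
  exact h i j

theorem mpow_eq_eigenvectorUnitary_mul {n : ℕ} {A : Matrix (Fin n) (Fin n) ℂ}
    (hA : A.IsHermitian) (v : ℝ) :
    mpow A v = (hA.eigenvectorUnitary : Matrix (Fin n) (Fin n) ℂ) *
      Matrix.diagonal (fun i => ((hA.eigenvalues i ^ v : ℝ) : ℂ)) *
      star (hA.eigenvectorUnitary : Matrix (Fin n) (Fin n) ℂ) := by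
  rw [mpow, hA.cfc_eq, Matrix.IsHermitian.cfc, Unitary.conjStarAlgAut_apply]
  rfl

theorem mpow_mul_mul_mpow {n : ℕ} {A B : Matrix (Fin n) (Fin n) ℂ} (hA : A.IsHermitian)
    (hB : B.IsHermitian) (X : Matrix (Fin n) (Fin n) ℂ) (p q : ℝ) :
    mpow A p * X * mpow B q = (hA.eigenvectorUnitary : Matrix (Fin n) (Fin n) ℂ) *
      Matrix.of (fun k l => ((hA.eigenvalues k ^ p * hB.eigenvalues l ^ q : ℝ) : ℂ) *
        (star (hA.eigenvectorUnitary : Matrix (Fin n) (Fin n) ℂ) * X *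
          (hB.eigenvectorUnitary : Matrix (Fin n) (Fin n) ℂ)) k l) *
      star (hB.eigenvectorUnitary : Matrix (Fin n) (Fin n) ℂ) := by
  set U := (hA.eigenvectorUnitary : Matrix (Fin n) (Fin n) ℂ)
  set V := (hB.eigenvectorUnitary : Matrix (Fin n) (Fin n) ℂ)
  have h : Matrix.of (fun k l => ((hA.eigenvalues k ^ p * hB.eigenvalues l ^ q : ℝ) : ℂ) *
      (star U * X * V) k l) =
      Matrix.diagonal (fun i => ((hA.eigenvalues i ^ p : ℝ) : ℂ)) * (star U * X * V) *
        Matrix.diagonal (fun i => ((hB.eigenvalues i ^ q : ℝ) : ℂ)) := by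
    ext k l
    rw [Matrix.mul_diagonal, Matrix.diagonal_mul, Matrix.of_apply]
    push_cast
    ring
  rw [h, mpow_eq_eigenvectorUnitary_mul hA, mpow_eq_eigenvectorUnitary_mul hB]
  simp only [mul_assoc, U, V]

theorem mInt_eq {n : ℕ} {A B : Matrix (Fin n) (Fin n) ℂ} (hA : A.PosSemidef)
    (hB : B.PosSemidef) (X : Matrix (Fin n) (Fin n) ℂ) {s : ℝ} (hs0 : 0 ≤ s) (hs : s < 1 / 2) :
    mInt A B X s = (hA.1.eigenvectorUnitary : Matrix (Fin n) (Fin n) ℂ) *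
      Matrix.of (fun k l => ((∫ v in s..(1 - s),
          hA.1.eigenvalues k ^ v * hB.1.eigenvalues l ^ (1 - v) : ℝ) : ℂ) *
        (star (hA.1.eigenvectorUnitary : Matrix (Fin n) (Fin n) ℂ) * X *
          (hB.1.eigenvectorUnitary : Matrix (Fin n) (Fin n) ℂ)) k l) *
      star (hB.1.eigenvectorUnitary : Matrix (Fin n) (Fin n) ℂ) := by
  have hint (k l : Fin n) : IntervalIntegrable (fun v : ℝ =>
      ((hA.1.eigenvalues k ^ v * hB.1.eigenvalues l ^ (1 - v) : ℝ) : ℂ))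
      MeasureTheory.volume s (1 - s) :=
    have h := intervalIntegrable_rpow_mul_rpow (hA.eigenvalues_nonneg k)
      (hB.eigenvalues_nonneg l) hs0 hs
    ⟨MeasureTheory.Integrable.ofReal h.1, MeasureTheory.Integrable.ofReal h.2⟩
  ext i j
  simp only [mInt, Matrix.of_apply, mpow_mul_mul_mpow hA.1 hB.1]
  generalize star (hA.1.eigenvectorUnitary : Matrix (Fin n) (Fin n) ℂ) * X *
    (hB.1.eigenvectorUnitary : Matrix (Fin n) (Fin n) ℂ) = Y
  simp only [Matrix.mul_apply (M := _ * _), Matrix.mul_apply (N := Matrix.of _), Matrix.of_apply]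
  rw [intervalIntegral.integral_finsetSum fun l _ => ?_]
  · refine Finset.sum_congr rfl fun l _ => ?_
    rw [intervalIntegral.integral_mul_const, intervalIntegral.integral_finsetSum fun k _ =>
      ((hint k l).mul_const _).const_mul _]
    simp only [intervalIntegral.integral_mul_const, intervalIntegral.integral_const_mul,
      intervalIntegral.integral_ofReal]
  · refine IntervalIntegrable.mul_const ?_ _
    simpa only [Finset.sum_fn] using IntervalIntegrable.sum Finset.univ fun k _ =>
      ((hint k l).mul_const (Y k l)).const_mul ((hA.1.eigenvectorUnitary :
        Matrix (Fin n) (Fin n) ℂ) i k)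

/-- Theorem 2.4 for the Frobenius norm. -/
theorem genLog_le_heinz_frobenius (n : ℕ) (A B X : Matrix (Fin n) (Fin n) ℂ)
    (hA : A.PosSemidef) (hB : B.PosSemidef) (s : ℝ) (hs0 : 0 ≤ s) (hs : s < 1 / 2) :
    frobNorm (mInt A B X s) ≤
      ((1 - 2 * s) / 2) *
        frobNorm (mpow A (1 - s) * X * mpow B s + mpow A s * X * mpow B (1 - s)) := by
  rw [mInt_eq hA hB X hs0 hs, mpow_mul_mul_mpow hA.1 hB.1, mpow_mul_mul_mpow hA.1 hB.1,
    ← add_mul, ← mul_add, frobNorm_unitary_mul_mul_star, frobNorm_unitary_mul_mul_star]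
  refine frobNorm_le_mul_of_forall_norm_le (by linarith) fun k l => ?_
  have ha := hA.eigenvalues_nonneg k
  have hb := hB.eigenvalues_nonneg l
  have hle : s ≤ 1 - s := by linarith
  rw [Matrix.add_apply, Matrix.of_apply, Matrix.of_apply, Matrix.of_apply, ← add_mul,
    ← Complex.ofReal_add, norm_mul, norm_mul, Complex.norm_real, Complex.norm_real,
    Real.norm_of_nonneg (intervalIntegral.integral_nonneg hle fun v _ => by positivity),
    Real.norm_of_nonneg (by positivity), ← mul_assoc]
  gcongr
  exact integral_rpow_mul_rpow_le ha hb hs0 hs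
end
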